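/- arXiv:1911.10610 — 2 statements merged into one kernel-verified Lean document; each statement's English description precedes it below -/
import Mathlib

section
/- Let P be a set of 2n (uncolored) points in the plane, n ≥ 1, and let M be a max-sum matching of P. Then all the disks D_{pq} with (p,q) ∈ M have a common point: the intersection ⋂_{(p,q)∈M} D_{pq} is nonempty. -/
noncomputable section

/-- Points of the plane with the Euclidean norm. -/
abbrev Pt : Type := EuclideanSpace ℝ (Fin 2)

/-- The closed disk with diameter the segment `pq`: center `(p+q)/2`, radius `‖p-q‖/2`. -/
def disk (p q : Pt) : Set Pt := Metric.closedBall (midpoint ℝ p q) (dist p q / 2)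


/-- A fixed-point-free involution of the index set: a perfect matching of the indices. -/
def IsPairing {m : ℕ} (σ : Equiv.Perm (Fin m)) : Prop := ∀ i, σ i ≠ i ∧ σ (σ i) = i

/-- Twice the total Euclidean length of the matching induced by the pairing `σ`. -/
def matchCost {m : ℕ} (x : Fin m → Pt) (σ : Equiv.Perm (Fin m)) : ℝ :=
  ∑ i, dist (x i) (x (σ i))

/-- The pairing `σ` is a max-sum matching of the points `x 0, …, x (m-1)`. -/
def IsMaxSumMatching {m : ℕ} (x : Fin m → Pt) (σ : Equiv.Perm (Fin m)) : Prop :=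
  IsPairing σ ∧ ∀ τ : Equiv.Perm (Fin m), IsPairing τ → matchCost x τ ≤ matchCost x σ

/-- Twice-angle form of the chord identity behind every exchange inequality below. -/
theorem cos_exchange (w u u' : ℝ) :
    Real.cos (2 * w - 2 * u) - Real.cos (2 * w - 2 * u') - (1 - Real.cos (2 * u - 2 * u')) =
      4 * Real.sin (w - u) * Real.sin (u - u') * Real.cos (w - u') := by
  have h1 : 2 * w - 2 * u = 2 * (w - u) := by ring
  have h2 : 2 * w - 2 * u' = 2 * ((w - u) + (u - u')) := by ring
  have h3 : 2 * u - 2 * u' = 2 * (u - u') := by ring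
  have h4 : w - u' = (w - u) + (u - u') := by ring
  rw [h1, h2, h3, h4]
  generalize w - u = a
  generalize u - u' = e
  rw [Real.cos_two_mul, Real.cos_two_mul, Real.cos_two_mul, Real.cos_add]
  linear_combination (2 * Real.sin e ^ 2) * Real.sin_sq_add_cos_sq a +
    (2 - 2 * Real.cos a ^ 2) * Real.sin_sq_add_cos_sq e

theorem sum_dist_conj_le {m : ℕ} {x : Fin m → Pt} {σ : Equiv.Perm (Fin m)}
    (h : IsMaxSumMatching x σ) (π : Equiv.Perm (Fin m)) :
    ∑ i, dist (x (π i)) (x (π (σ i))) ≤ ∑ i, dist (x i) (x (σ i)) := by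
  have hp : IsPairing (π * σ * π⁻¹) := by
    intro i
    constructor
    · intro hi
      apply (h.1 (π⁻¹ i)).1
      apply π.injective
      simpa using hi
    · have hi := (h.1 (π⁻¹ i)).2
      simp only [Equiv.Perm.mul_apply]
      rw [show π⁻¹ (π (σ (π⁻¹ i))) = σ (π⁻¹ i) from Equiv.symm_apply_apply π _, hi]
      exact Equiv.apply_symm_apply π i
  have := h.2 _ hp
  unfold matchCost at this
  rw [← Equiv.sum_comp π] at this
  simpa using this

/-- Two edges of a max-sum matching cannot be improved by swapping endpoints. -/
theorem dist_swap_le {m : ℕ} {x : Fin m → Pt} {σ : Equiv.Perm (Fin m)}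
    (h : IsMaxSumMatching x σ) {i j : Fin m} (hij : j ≠ i) (hij' : j ≠ σ i) :
    dist (x i) (x (σ j)) + dist (x j) (x (σ i)) ≤
      dist (x i) (x (σ i)) + dist (x j) (x (σ j)) := by
  have hi := h.1 i
  have hj := h.1 j
  have hsij : σ j ≠ σ i := σ.injective.ne hij
  have hsj : σ j ≠ i := fun e => hij' (by rw [← e, hj.2])
  have key := sum_dist_conj_le h (Equiv.swap (σ i) (σ j))
  have hsub : ∑ b, (dist (x b) (x (σ b)) -
      dist (x (Equiv.swap (σ i) (σ j) b)) (x (Equiv.swap (σ i) (σ j) (σ b)))) =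
      ∑ b ∈ ({i, j, σ i, σ j} : Finset (Fin m)), (dist (x b) (x (σ b)) -
      dist (x (Equiv.swap (σ i) (σ j) b)) (x (Equiv.swap (σ i) (σ j) (σ b)))) := by
    symm
    apply Finset.sum_subset (Finset.subset_univ _)
    intro b _ hb
    simp only [Finset.mem_insert, Finset.mem_singleton, not_or] at hb
    rw [Equiv.swap_apply_of_ne_of_ne hb.2.2.1 hb.2.2.2,
      Equiv.swap_apply_of_ne_of_ne (σ.injective.ne hb.1) (σ.injective.ne hb.2.1), sub_self]
  rw [Finset.sum_sub_distrib, Finset.sum_insert, Finset.sum_insert, Finset.sum_insert,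
    Finset.sum_singleton] at hsub
  · simp only [hi.2, hj.2, Equiv.swap_apply_left, Equiv.swap_apply_right,
      Equiv.swap_apply_of_ne_of_ne hi.1.symm hsj.symm,
      Equiv.swap_apply_of_ne_of_ne hij' hj.1.symm] at hsub
    rw [dist_comm (x (σ i)) (x i), dist_comm (x (σ j)) (x j), dist_comm (x (σ j)) (x i),
      dist_comm (x (σ i)) (x j)] at hsub
    linarith
  · simpa using hsij.symm
  · simpa using ⟨hij', hj.1.symm⟩
  · simpa using ⟨hij.symm, hi.1.symm, hsj.symm⟩

theorem dist_swap_apply_le {m : ℕ} {x : Fin m → Pt} {σ : Equiv.Perm (Fin m)}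
    (h : IsMaxSumMatching x σ) {i j : Fin m} (hij : j ≠ i) (hij' : j ≠ σ i) :
    dist (x i) (x j) + dist (x (σ i)) (x (σ j)) ≤
      dist (x i) (x (σ i)) + dist (x j) (x (σ j)) := by
  have := dist_swap_le h (i := i) (j := σ j) (fun e => hij' (by rw [← e, (h.1 j).2]))
    (σ.injective.ne hij)
  rw [(h.1 j).2] at this
  linarith [dist_comm (x j) (x (σ j)), dist_comm (x (σ j)) (x (σ i))]

/-- Three edges of a max-sum matching cannot be improved by shifting endpoints cyclically. -/
theorem dist_cycle_le {m : ℕ} {x : Fin m → Pt} {σ : Equiv.Perm (Fin m)}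
    (h : IsMaxSumMatching x σ) {i j k : Fin m} (hij : j ≠ i) (hij' : j ≠ σ i)
    (hjk : k ≠ j) (hjk' : k ≠ σ j) (hki : i ≠ k) (hki' : i ≠ σ k) :
    dist (x i) (x (σ j)) + dist (x j) (x (σ k)) + dist (x k) (x (σ i)) ≤
      dist (x i) (x (σ i)) + dist (x j) (x (σ j)) + dist (x k) (x (σ k)) := by
  have hi := h.1 i
  have hj := h.1 j
  have hk := h.1 k
  have h1 : σ j ≠ σ i := σ.injective.ne hij
  have h2 : σ k ≠ σ j := σ.injective.ne hjk
  have h3 : σ i ≠ σ k := σ.injective.ne hki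
  have h4 : σ j ≠ i := fun e => hij' (by rw [← e, hj.2])
  have h5 : σ k ≠ j := fun e => hjk' (by rw [← e, hk.2])
  have h6 : σ i ≠ k := fun e => hki' (by rw [← e, hi.2])
  set π : Equiv.Perm (Fin m) := Equiv.swap (σ i) (σ j) * Equiv.swap (σ j) (σ k) with hπ
  have π0 : ∀ b, b ≠ σ i → b ≠ σ j → b ≠ σ k → π b = b := by
    intro b hb1 hb2 hb3
    rw [hπ, Equiv.Perm.mul_apply, Equiv.swap_apply_of_ne_of_ne hb2 hb3,
      Equiv.swap_apply_of_ne_of_ne hb1 hb2]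
  have π1 : π (σ i) = σ j := by
    rw [hπ, Equiv.Perm.mul_apply, Equiv.swap_apply_of_ne_of_ne h1.symm h3,
      Equiv.swap_apply_left]
  have π2 : π (σ j) = σ k := by
    rw [hπ, Equiv.Perm.mul_apply, Equiv.swap_apply_left,
      Equiv.swap_apply_of_ne_of_ne h3.symm h2]
  have π3 : π (σ k) = σ i := by
    rw [hπ, Equiv.Perm.mul_apply, Equiv.swap_apply_right, Equiv.swap_apply_right]
  have key := sum_dist_conj_le h π
  have hsub : ∑ b, (dist (x b) (x (σ b)) - dist (x (π b)) (x (π (σ b)))) =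
      ∑ b ∈ ({i, j, k, σ i, σ j, σ k} : Finset (Fin m)),
        (dist (x b) (x (σ b)) - dist (x (π b)) (x (π (σ b)))) := by
    symm
    apply Finset.sum_subset (Finset.subset_univ _)
    intro b _ hb
    simp only [Finset.mem_insert, Finset.mem_singleton, not_or] at hb
    obtain ⟨b1, b2, b3, b4, b5, b6⟩ := hb
    rw [π0 b b4 b5 b6, π0 (σ b) (σ.injective.ne b1) (σ.injective.ne b2) (σ.injective.ne b3),
      sub_self]
  rw [Finset.sum_sub_distrib, Finset.sum_insert, Finset.sum_insert, Finset.sum_insert,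
    Finset.sum_insert, Finset.sum_insert, Finset.sum_singleton] at hsub
  · simp only [hi.2, hj.2, hk.2, π1, π2, π3, π0 i hi.1.symm h4.symm hki',
      π0 j hij' hj.1.symm h5.symm, π0 k h6.symm hjk' hk.1.symm] at hsub
    rw [dist_comm (x (σ i)) (x i), dist_comm (x (σ j)) (x j), dist_comm (x (σ k)) (x k),
      dist_comm (x (σ j)) (x i), dist_comm (x (σ k)) (x j), dist_comm (x (σ i)) (x k)] at hsub
    linarith
  · simpa using h2.symm
  · simpa using ⟨hij.symm, hki⟩
  · simpa using ⟨h6.symm, hjk', hk.1.symm⟩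
  · simpa using ⟨hjk.symm, hij', hj.1.symm, h5.symm⟩
  · simpa using ⟨hij.symm, hki, hi.1.symm, h4.symm, hki'⟩

theorem coord_le_dist (P Q : Pt) (θ : ℝ) :
    (P 0 - Q 0) * Real.cos θ + (P 1 - Q 1) * Real.sin θ ≤ dist P Q := by
  rw [EuclideanSpace.dist_eq, Fin.sum_univ_two, Real.dist_eq, Real.dist_eq, sq_abs, sq_abs]
  apply Real.le_sqrt_of_sq_le
  nlinarith [sq_nonneg ((P 0 - Q 0) * Real.sin θ - (P 1 - Q 1) * Real.cos θ),
    Real.sin_sq_add_cos_sq θ]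

theorem cross_eq_zero_of_dist_le {P Q : Pt} {θ : ℝ}
    (h : dist P Q ≤ (P 0 - Q 0) * Real.cos θ + (P 1 - Q 1) * Real.sin θ) :
    (P 0 - Q 0) * Real.sin θ - (P 1 - Q 1) * Real.cos θ = 0 := by
  rw [EuclideanSpace.dist_eq, Fin.sum_univ_two, Real.dist_eq, Real.dist_eq, sq_abs, sq_abs] at h
  have h2 := (Real.sqrt_le_left (le_trans (Real.sqrt_nonneg _) h)).1 h
  have h3 : ((P 0 - Q 0) * Real.sin θ - (P 1 - Q 1) * Real.cos θ) ^ 2 ≤ 0 := by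
    nlinarith [Real.sin_sq_add_cos_sq θ]
  exact pow_eq_zero_iff two_ne_zero |>.1 (le_antisymm h3 (sq_nonneg _))

/-- The segment `PQ` has half-length `r` and direction `2 * u`, and its midpoint has polar
coordinates `(R, 2 * w)` around `o`, which lies outside the disk with diameter `PQ`. -/
structure IsFrame (o P Q : Pt) (R w u r : ℝ) : Prop where
  nonneg : 0 ≤ r
  lt : r < R
  fst_zero : P 0 = o 0 + R * Real.cos (2 * w) + r * Real.cos (2 * u)
  fst_one : P 1 = o 1 + R * Real.sin (2 * w) + r * Real.sin (2 * u)
  snd_zero : Q 0 = o 0 + R * Real.cos (2 * w) - r * Real.cos (2 * u)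
  snd_one : Q 1 = o 1 + R * Real.sin (2 * w) - r * Real.sin (2 * u)

namespace IsFrame

variable {o P Q P' Q' P'' Q'' : Pt} {R w u r R' w' u' r' R'' w'' u'' r'' : ℝ}

theorem flip (h : IsFrame o P Q R w u r) : IsFrame o Q P R w (u + Real.pi / 2) r := by
  have e : 2 * (u + Real.pi / 2) = 2 * u + Real.pi := by ring
  refine ⟨h.nonneg, h.lt, ?_, ?_, ?_, ?_⟩ <;> rw [e] <;>
    simp only [Real.cos_add_pi, Real.sin_add_pi]
  · rw [h.snd_zero]; ring
  · rw [h.snd_one]; ring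
  · rw [h.fst_zero]; ring
  · rw [h.fst_one]; ring

theorem add_pi (h : IsFrame o P Q R w u r) : IsFrame o P Q R (w + Real.pi) (u + Real.pi) r := by
  refine ⟨h.nonneg, h.lt, ?_, ?_, ?_, ?_⟩ <;> rw [mul_add, mul_add] <;>
    simp only [Real.cos_add_two_pi, Real.sin_add_two_pi]
  · exact h.fst_zero
  · exact h.fst_one
  · exact h.snd_zero
  · exact h.snd_one

theorem dist_eq (h : IsFrame o P Q R w u r) : dist P Q = 2 * r := by
  rw [EuclideanSpace.dist_eq, Fin.sum_univ_two, Real.dist_eq, Real.dist_eq, sq_abs, sq_abs,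
    h.fst_zero, h.fst_one, h.snd_zero, h.snd_one, Real.sqrt_eq_iff_mul_self_eq]
  · linear_combination (4 * r ^ 2) * Real.sin_sq_add_cos_sq (2 * u)
  · positivity
  · linarith [h.nonneg]

theorem le_dist (h : IsFrame o P Q R w u r) (h' : IsFrame o P' Q' R' w' u' r') :
    R * Real.cos (2 * w - 2 * u) - R' * Real.cos (2 * w' - 2 * u) + r +
      r' * Real.cos (2 * u' - 2 * u) ≤ dist P Q' := by
  refine le_trans (le_of_eq ?_) (coord_le_dist P Q' (2 * u))
  rw [h.fst_zero, h.fst_one, h'.snd_zero, h'.snd_one, Real.cos_sub, Real.cos_sub, Real.cos_sub]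
  linear_combination (-r) * Real.sin_sq_add_cos_sq (2 * u)

/-- Exchange inequality for two edges, in half-angle form. -/
theorem swap_nonpos (h : IsFrame o P Q R w u r) (h' : IsFrame o P' Q' R' w' u' r')
    (hs : dist P Q' + dist P' Q ≤ dist P Q + dist P' Q') :
    R * (Real.sin (w - u) * Real.sin (u - u') * Real.cos (w - u')) +
      R' * (Real.sin (w' - u') * Real.sin (u' - u) * Real.cos (w' - u)) ≤ 0 := by
  have h1 := h.le_dist h'
  have h2 := h'.le_dist h
  rw [h.dist_eq, h'.dist_eq] at hs
  have e1 := cos_exchange w u u'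
  have e2 := cos_exchange w' u' u
  have e3 : Real.cos (2 * u' - 2 * u) = Real.cos (2 * u - 2 * u') := by
    rw [← Real.cos_neg]; congr 1; ring
  rw [e3] at h1 e2
  have c := Real.cos_le_one (2 * u - 2 * u')
  have l1 := mul_le_mul_of_nonneg_right h.lt.le (sub_nonneg.2 c)
  have l2 := mul_le_mul_of_nonneg_right h'.lt.le (sub_nonneg.2 c)
  have f1 := congrArg (R * ·) e1
  have f2 := congrArg (R' * ·) e2
  linarith

/-- Exchange inequality for three edges, in half-angle form. -/
theorem cycle_neg (h : IsFrame o P Q R w u r) (h' : IsFrame o P' Q' R' w' u' r')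
    (h'' : IsFrame o P'' Q'' R'' w'' u'' r'') (hu : Real.cos (2 * u - 2 * u'') < 1)
    (hs : dist P Q' + dist P' Q'' + dist P'' Q ≤ dist P Q + dist P' Q' + dist P'' Q'') :
    R * (Real.sin (w - u) * Real.sin (u - u'') * Real.cos (w - u'')) +
      R' * (Real.sin (w' - u') * Real.sin (u' - u) * Real.cos (w' - u)) +
      R'' * (Real.sin (w'' - u'') * Real.sin (u'' - u') * Real.cos (w'' - u')) < 0 := by
  have h1 := h.le_dist h'
  have h2 := h'.le_dist h''
  have h3 := h''.le_dist h
  rw [h.dist_eq, h'.dist_eq, h''.dist_eq] at hs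
  have l1 := mul_lt_mul_of_pos_right h.lt (sub_pos.2 hu)
  have l2 := mul_le_mul_of_nonneg_right h'.lt.le (sub_nonneg.2 (Real.cos_le_one (2 * u' - 2 * u)))
  have l3 := mul_le_mul_of_nonneg_right h''.lt.le
    (sub_nonneg.2 (Real.cos_le_one (2 * u'' - 2 * u')))
  have f1 := congrArg (R * ·) (cos_exchange w u u'')
  have f2 := congrArg (R' * ·) (cos_exchange w' u' u)
  have f3 := congrArg (R'' * ·) (cos_exchange w'' u'' u')
  linarith

/-- Parallel edges that cannot be improved by a swap are collinear. -/
theorem collinear_of_swap (h : IsFrame o P Q R w u r) (h' : IsFrame o P' Q' R' w' u r')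
    (hs : dist P Q' + dist P' Q ≤ dist P Q + dist P' Q') :
    R * Real.sin (2 * (w - u)) = R' * Real.sin (2 * (w' - u)) := by
  have h2 := h'.le_dist h
  rw [h.dist_eq, h'.dist_eq] at hs
  rw [sub_self, Real.cos_zero] at h2
  have e := cross_eq_zero_of_dist_le (P := P) (Q := Q') (θ := 2 * u) (by
    rw [h.fst_zero, h.fst_one, h'.snd_zero, h'.snd_one]
    rw [Real.cos_sub, Real.cos_sub] at h2
    linear_combination hs + h2 - (r + r') * Real.sin_sq_add_cos_sq (2 * u))
  rw [h.fst_zero, h.fst_one, h'.snd_zero, h'.snd_one] at e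
  rw [mul_sub, mul_sub, Real.sin_sub, Real.sin_sub]
  linear_combination -e

end IsFrame


namespace IsFrame

variable {o P Q P' Q' : Pt} {R w u r R' w' u' r' : ℝ}

theorem radius_pos (h : IsFrame o P Q R w u r) : 0 < R := h.nonneg.trans_lt h.lt

/-- Two edges seen from `o` at an angle less than `π` that cannot be improved by a swap have
directions that differ by less than `π`. -/
theorem sub_lt_pi_div_two (h : IsFrame o P Q R w u r) (h' : IsFrame o P' Q' R' w' u' r')
    (hs : dist P P' + dist Q Q' ≤ dist P Q + dist P' Q')
    (ha : 0 ≤ w - u) (ha2 : w - u < Real.pi / 2) (ha' : 0 ≤ w' - u') (ha2' : w' - u' < Real.pi / 2)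
    (hg : w < w') (hg2 : w' - w < Real.pi / 2) : u' - u < Real.pi / 2 := by
  have hR := h.radius_pos
  have hR' := h'.radius_pos
  by_contra! he
  rcases he.lt_or_eq with he | he
  · have h1 := h.flip.swap_nonpos h' (by
      rw [dist_comm Q P, dist_comm P' P]; linarith)
    have s1 : Real.sin (w - (u + Real.pi / 2)) = -Real.cos (w - u) := by
      rw [← Real.sin_sub_pi_div_two]; congr 1; ring
    have s2 : Real.sin (u + Real.pi / 2 - u') = Real.cos (u' - u) := by
      rw [← Real.sin_pi_div_two_sub]; congr 1; ring
    have s3 : Real.sin (u' - (u + Real.pi / 2)) = -Real.cos (u' - u) := by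
      rw [← Real.sin_sub_pi_div_two]; congr 1; ring
    have s4 : Real.cos (w' - (u + Real.pi / 2)) = Real.sin (w' - u) := by
      rw [← Real.cos_sub_pi_div_two]; congr 1; ring
    rw [s1, s2, s3, s4] at h1
    have c : Real.cos (u' - u) < 0 := Real.cos_neg_of_pi_div_two_lt_of_lt he (by linarith)
    have p1 : 0 < Real.cos (w - u) := Real.cos_pos_of_mem_Ioo ⟨by linarith, ha2⟩
    have p2 : 0 < Real.cos (w - u') := Real.cos_pos_of_mem_Ioo ⟨by linarith, by linarith⟩
    have p3 : 0 ≤ Real.sin (w' - u') :=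
      Real.sin_nonneg_of_nonneg_of_le_pi ha' (by linarith [Real.pi_pos])
    have p4 : 0 ≤ Real.sin (w' - u) :=
      Real.sin_nonneg_of_nonneg_of_le_pi (by linarith) (by linarith)
    have q1 := mul_pos hR (mul_pos p1 p2)
    have q2 := mul_nonneg hR'.le (mul_nonneg p3 p4)
    nlinarith [mul_pos (neg_pos.2 c) (add_pos_of_pos_of_nonneg q1 q2)]
  · obtain rfl : u' = u + Real.pi / 2 := by linarith
    have h1 := h.flip.collinear_of_swap h' (by
      rw [dist_comm Q P, dist_comm P' P]; linarith)
    have s1 : Real.sin (2 * (w - (u + Real.pi / 2))) = -Real.sin (2 * (w - u)) := by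
      rw [← Real.sin_sub_pi]; congr 1; ring
    rw [s1] at h1
    have p1 : 0 < 2 * (w' - (u + Real.pi / 2)) ∨ 0 < 2 * (w - u) := by
      by_contra! hc
      linarith [hc.1, hc.2]
    have q1 : 0 ≤ Real.sin (2 * (w - u)) :=
      Real.sin_nonneg_of_nonneg_of_le_pi (by linarith) (by linarith)
    have q2 : 0 ≤ Real.sin (2 * (w' - (u + Real.pi / 2))) :=
      Real.sin_nonneg_of_nonneg_of_le_pi (by linarith) (by linarith)
    rcases p1 with p | p
    · have := mul_pos hR' (Real.sin_pos_of_pos_of_lt_pi p (by linarith))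
      nlinarith
    · have := mul_pos hR (Real.sin_pos_of_pos_of_lt_pi p (by linarith))
      nlinarith

theorem swap_le (h : IsFrame o P Q R w u r) (h' : IsFrame o P' Q' R' w' u' r')
    (hs : dist P P' + dist Q Q' ≤ dist P Q + dist P' Q') (he : 0 < Real.cos (u' - u)) :
    R * (Real.sin (w - u) * Real.sin (u' - u - (w - u))) ≤
      R' * (Real.cos (w' - u') * Real.cos (w' - u' + (u' - u))) := by
  rw [sub_sub_sub_cancel_right, sub_add_sub_cancel]
  have h1 := h.swap_nonpos h'.flip (by
    rw [dist_comm Q' P', dist_comm Q' Q]; linarith)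
  have s1 : Real.sin (w' - (u' + Real.pi / 2)) = -Real.cos (w' - u') := by
    rw [← Real.sin_sub_pi_div_two]; congr 1; ring
  have s2 : Real.sin (u - (u' + Real.pi / 2)) = -Real.cos (u' - u) := by
    rw [← Real.cos_neg, ← Real.sin_sub_pi_div_two]; congr 1; ring
  have s3 : Real.sin (u' + Real.pi / 2 - u) = Real.cos (u' - u) := by
    rw [← Real.sin_add_pi_div_two]; congr 1; ring
  have s4 : Real.cos (w - (u' + Real.pi / 2)) = -Real.sin (u' - w) := by
    rw [← Real.sin_neg, ← Real.cos_sub_pi_div_two]; congr 1; ring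
  rw [s1, s2, s3, s4] at h1
  refine le_of_mul_le_mul_left ?_ he
  linarith

end IsFrame

theorem false_of_exchange {R₁ R₂ R₃ a₁ a₂ a₃ e₁ e₂ e₃ : ℝ}
    (hR₁ : 0 < R₁) (hR₂ : 0 < R₂) (hR₃ : 0 < R₃)
    (ha₁ : 0 ≤ a₁) (ha₂ : 0 ≤ a₂) (ha₃ : 0 ≤ a₃)
    (hb₁ : a₁ < Real.pi / 2) (hb₂ : a₂ < Real.pi / 2) (hb₃ : a₃ < Real.pi / 2)
    (he₁ : e₁ < Real.pi / 2) (he₂ : e₂ < Real.pi / 2) (he₃ : e₃ < Real.pi / 2)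
    (hsum : e₁ + e₂ + e₃ = Real.pi)
    (h₁ : R₁ * (Real.sin a₁ * Real.sin (e₁ - a₁)) ≤ R₂ * (Real.cos a₂ * Real.cos (a₂ + e₁)))
    (h₂ : R₂ * (Real.sin a₂ * Real.sin (e₂ - a₂)) ≤ R₃ * (Real.cos a₃ * Real.cos (a₃ + e₂)))
    (h₃ : R₃ * (Real.sin a₃ * Real.sin (e₃ - a₃)) ≤ R₁ * (Real.cos a₁ * Real.cos (a₁ + e₃)))
    (hc : R₁ * (Real.sin a₁ * Real.sin e₃ * Real.cos (a₁ + e₃)) +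
      R₂ * (Real.sin a₂ * Real.sin e₁ * Real.cos (a₂ + e₁)) +
      R₃ * (Real.sin a₃ * Real.sin e₂ * Real.cos (a₃ + e₂)) < 0)
    (hc' : R₁ * (Real.cos a₁ * Real.sin e₁ * Real.sin (a₁ - e₁)) +
      R₂ * (Real.cos a₂ * Real.sin e₂ * Real.sin (a₂ - e₂)) +
      R₃ * (Real.cos a₃ * Real.sin e₃ * Real.sin (a₃ - e₃)) < 0) : False := by
  have hpi := Real.pi_pos
  have sinpos : ∀ {e : ℝ}, 0 < e → e < Real.pi / 2 → 0 < Real.sin e := fun h h' =>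
    Real.sin_pos_of_pos_of_lt_pi h (by linarith)
  have sinnn : ∀ {e : ℝ}, 0 ≤ e → e < Real.pi / 2 → 0 ≤ Real.sin e := fun h h' =>
    Real.sin_nonneg_of_nonneg_of_le_pi h (by linarith)
  have cospos : ∀ {e : ℝ}, 0 ≤ e → e < Real.pi / 2 → 0 < Real.cos e := fun h h' =>
    Real.cos_pos_of_mem_Ioo ⟨by linarith, h'⟩
  have step : ∀ {R R' a a' e : ℝ}, 0 < R → 0 < R' → 0 ≤ a → a < Real.pi / 2 → 0 ≤ a' →
      a' < Real.pi / 2 → e < Real.pi / 2 →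
      R * (Real.sin a * Real.sin (e - a)) ≤ R' * (Real.cos a' * Real.cos (a' + e)) →
      Real.cos (a' + e) < 0 → e < a := by
    intro R R' a a' e hR hR' ha hb ha' hb' he h hn
    by_contra! hle
    have p := mul_nonneg hR.le (mul_nonneg (sinnn ha hb) (sinnn (sub_nonneg.2 hle) (by linarith)))
    have q := mul_pos hR' (mul_pos (cospos ha' hb') (neg_pos.2 hn))
    linarith
  have cosneg : ∀ {a e : ℝ}, a < Real.pi / 2 → e < Real.pi / 2 → Real.pi / 2 < a + e →
      Real.cos (a + e) < 0 := fun h h' h'' =>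
    Real.cos_neg_of_pi_div_two_lt_of_lt h'' (by linarith)
  have A₁ : Real.cos (a₂ + e₁) < 0 → e₁ < a₁ := step hR₁ hR₂ ha₁ hb₁ ha₂ hb₂ he₁ h₁
  have A₂ : Real.cos (a₃ + e₂) < 0 → e₂ < a₂ := step hR₂ hR₃ ha₂ hb₂ ha₃ hb₃ he₂ h₂
  have A₃ : Real.cos (a₁ + e₃) < 0 → e₃ < a₃ := step hR₃ hR₁ ha₃ hb₃ ha₁ hb₁ he₃ h₃
  have B₁ : e₁ < a₁ → e₃ < a₃ := fun h => A₃ (cosneg hb₁ he₃ (by linarith))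
  have B₂ : e₂ < a₂ → e₁ < a₁ := fun h => A₁ (cosneg hb₂ he₁ (by linarith))
  have B₃ : e₃ < a₃ → e₂ < a₂ := fun h => A₂ (cosneg hb₃ he₂ (by linarith))
  have s₁ := sinpos (e := e₁) (by linarith) he₁
  have s₂ := sinpos (e := e₂) (by linarith) he₂
  have s₃ := sinpos (e := e₃) (by linarith) he₃
  have C₁ : e₁ < a₁ := by
    by_contra hn
    have n₁ : 0 ≤ Real.cos (a₂ + e₁) := le_of_not_gt fun h => hn (A₁ h)
    have n₂ : 0 ≤ Real.cos (a₃ + e₂) := le_of_not_gt fun h => hn (B₂ (A₂ h))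
    have n₃ : 0 ≤ Real.cos (a₁ + e₃) := le_of_not_gt fun h => hn (B₂ (B₃ (A₃ h)))
    have p₁ := mul_nonneg hR₁.le (mul_nonneg (mul_nonneg (sinnn ha₁ hb₁) s₃.le) n₃)
    have p₂ := mul_nonneg hR₂.le (mul_nonneg (mul_nonneg (sinnn ha₂ hb₂) s₁.le) n₁)
    have p₃ := mul_nonneg hR₃.le (mul_nonneg (mul_nonneg (sinnn ha₃ hb₃) s₂.le) n₂)
    linarith
  have C₃ := B₁ C₁
  have C₂ := B₃ C₃
  have p₁ := mul_pos hR₁ (mul_pos (mul_pos (cospos ha₁ hb₁) s₁)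
    (sinpos (sub_pos.2 C₁) (by linarith)))
  have p₂ := mul_pos hR₂ (mul_pos (mul_pos (cospos ha₂ hb₂) s₂)
    (sinpos (sub_pos.2 C₂) (by linarith)))
  have p₃ := mul_pos hR₃ (mul_pos (mul_pos (cospos ha₃ hb₃) s₃)
    (sinpos (sub_pos.2 C₃) (by linarith)))
  linarith

/-- Three edges whose disks miss `o`, and which are seen from `o` in directions that positively
span the plane, can be improved by an exchange. -/
theorem false_of_frames {o P₁ Q₁ P₂ Q₂ P₃ Q₃ : Pt} {R₁ w₁ u₁ r₁ R₂ w₂ u₂ r₂ R₃ w₃ u₃ r₃ : ℝ}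
    (f₁ : IsFrame o P₁ Q₁ R₁ w₁ u₁ r₁) (f₂ : IsFrame o P₂ Q₂ R₂ w₂ u₂ r₂)
    (f₃ : IsFrame o P₃ Q₃ R₃ w₃ u₃ r₃)
    (ha₁ : 0 ≤ w₁ - u₁) (ha₂ : 0 ≤ w₂ - u₂) (ha₃ : 0 ≤ w₃ - u₃)
    (hb₁ : w₁ - u₁ < Real.pi / 2) (hb₂ : w₂ - u₂ < Real.pi / 2) (hb₃ : w₃ - u₃ < Real.pi / 2)
    (hw₁ : w₁ < w₂) (hw₂ : w₂ < w₃) (hw₃ : w₃ < w₁ + Real.pi)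
    (hg₁ : w₂ - w₁ < Real.pi / 2) (hg₂ : w₃ - w₂ < Real.pi / 2)
    (hg₃ : w₁ + Real.pi - w₃ < Real.pi / 2)
    (s₁ : dist P₁ P₂ + dist Q₁ Q₂ ≤ dist P₁ Q₁ + dist P₂ Q₂)
    (s₂ : dist P₂ P₃ + dist Q₂ Q₃ ≤ dist P₂ Q₂ + dist P₃ Q₃)
    (s₃ : dist P₃ P₁ + dist Q₃ Q₁ ≤ dist P₃ Q₃ + dist P₁ Q₁)
    (c : dist P₁ Q₂ + dist P₂ Q₃ + dist P₃ Q₁ ≤ dist P₁ Q₁ + dist P₂ Q₂ + dist P₃ Q₃) :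
    False := by
  have e₁ := f₁.sub_lt_pi_div_two f₂ s₁ ha₁ hb₁ ha₂ hb₂ hw₁ hg₁
  have e₂ := f₂.sub_lt_pi_div_two f₃ s₂ ha₂ hb₂ ha₃ hb₃ hw₂ hg₂
  have e₃ := f₃.sub_lt_pi_div_two f₁.add_pi s₃ ha₃ hb₃ (by linarith) (by linarith) hw₃ hg₃
  have cospos : ∀ {e : ℝ}, 0 < e → e < Real.pi / 2 → 0 < Real.cos e := fun h h' =>
    Real.cos_pos_of_mem_Ioo ⟨by linarith, h'⟩
  have p₁ := f₁.swap_le f₂ s₁ (cospos (by linarith) e₁)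
  have p₂ := f₂.swap_le f₃ s₂ (cospos (by linarith) e₂)
  have p₃ := f₃.swap_le f₁.add_pi s₃ (cospos (by linarith) e₃)
  have sneg : Real.sin (u₁ - u₃) = -Real.sin (u₁ + Real.pi - u₃) := by
    rw [← Real.sin_sub_pi]; congr 1; ring
  have spos : 0 < Real.sin (u₁ + Real.pi - u₃) :=
    Real.sin_pos_of_pos_of_lt_pi (by linarith) (by linarith)
  have k : Real.cos (2 * u₁ - 2 * u₃) < 1 := by
    rw [show 2 * u₁ - 2 * u₃ = 2 * (u₁ - u₃) by ring, Real.cos_two_mul, Real.cos_sq', sneg]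
    nlinarith
  have k₁ := f₁.cycle_neg f₂ f₃ k c
  have k₂ := f₃.flip.cycle_neg f₂.flip f₁.flip (by
    rw [← Real.cos_neg]
    convert k using 2
    ring) (by
      rw [dist_comm Q₃ P₂, dist_comm Q₂ P₁, dist_comm Q₁ P₃, dist_comm Q₃ P₃, dist_comm Q₂ P₂,
        dist_comm Q₁ P₁]
      linarith [c])
  refine false_of_exchange f₁.radius_pos f₂.radius_pos f₃.radius_pos ha₁ ha₂ ha₃ hb₁ hb₂ hb₃
    e₁ e₂ e₃ (by ring) p₁ p₂ (by simpa only [add_sub_add_right_eq_sub] using p₃) ?_ ?_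
  · have h₁ : Real.cos (w₁ - u₁ + (u₁ + Real.pi - u₃)) = -Real.cos (w₁ - u₃) := by
      rw [← Real.cos_add_pi]; congr 1; ring
    have h₂ : w₂ - u₂ + (u₂ - u₁) = w₂ - u₁ := by ring
    have h₃ : w₃ - u₃ + (u₃ - u₂) = w₃ - u₂ := by ring
    rw [sneg] at k₁
    rw [h₁, h₂, h₃]
    linarith
  · have c₁ : ∀ w u, Real.sin (w - (u + Real.pi / 2)) = -Real.cos (w - u) := by
      intro w u
      rw [← Real.sin_sub_pi_div_two]; congr 1; ring
    have c₂ : ∀ w u, Real.cos (w - (u + Real.pi / 2)) = Real.sin (w - u) := by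
      intro w u
      rw [← Real.cos_sub_pi_div_two]; congr 1; ring
    have h₁ : w₁ - u₁ - (u₂ - u₁) = w₁ - u₂ := by ring
    have h₂ : w₂ - u₂ - (u₃ - u₂) = w₂ - u₃ := by ring
    have h₃ : Real.sin (w₃ - u₃ - (u₁ + Real.pi - u₃)) = -Real.sin (w₃ - u₁) := by
      rw [← Real.sin_sub_pi]; congr 1; ring
    have h₄ : Real.sin (u₃ - u₁) = Real.sin (u₁ + Real.pi - u₃) := by
      rw [← Real.sin_pi_sub]; congr 1; ring
    have h₅ : Real.sin (u₁ - u₂) = -Real.sin (u₂ - u₁) := by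
      rw [← Real.sin_neg]; congr 1; ring
    have h₆ : Real.sin (u₂ - u₃) = -Real.sin (u₃ - u₂) := by
      rw [← Real.sin_neg]; congr 1; ring
    simp only [c₁, c₂, add_sub_add_right_eq_sub, h₄, h₅, h₆] at k₂
    rw [h₁, h₂, h₃]
    linarith

theorem exists_polar (v : Pt) (s : ℝ) :
    ∃ θ, s < θ ∧ θ ≤ s + 2 * Real.pi ∧ v 0 = ‖v‖ * Real.cos θ ∧ v 1 = ‖v‖ * Real.sin θ := by
  have hn : ‖(⟨v 0, v 1⟩ : ℂ)‖ = ‖v‖ := by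
    rw [Complex.norm_eq_sqrt_sq_add_sq, EuclideanSpace.norm_eq, Fin.sum_univ_two,
      Real.norm_eq_abs, Real.norm_eq_abs, sq_abs, sq_abs]
  have hm := toIocMod_mem_Ioc Real.two_pi_pos s (Complex.arg ⟨v 0, v 1⟩)
  refine ⟨toIocMod Real.two_pi_pos s (Complex.arg ⟨v 0, v 1⟩), hm.1, hm.2, ?_, ?_⟩
  · rw [toIocMod, zsmul_eq_mul, Real.cos_sub_int_mul_two_pi, ← hn, Complex.norm_mul_cos_arg]
  · rw [toIocMod, zsmul_eq_mul, Real.sin_sub_int_mul_two_pi, ← hn, Complex.norm_mul_sin_arg]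

/-- Of the two orientations of a segment, one has a direction at most a right half-angle behind
the direction in which its midpoint is seen from `o`. -/
theorem exists_isFrame {o P Q : Pt} {R w : ℝ} (hR : dist P Q / 2 < R)
    (h0 : (midpoint ℝ P Q - o) 0 = R * Real.cos (2 * w))
    (h1 : (midpoint ℝ P Q - o) 1 = R * Real.sin (2 * w)) :
    ∃ u r, 0 ≤ w - u ∧ w - u < Real.pi / 2 ∧ (IsFrame o P Q R w u r ∨ IsFrame o Q P R w u r) := by
  obtain ⟨θ, hθ, hθ', c0, c1⟩ := exists_polar ((2⁻¹ : ℝ) • (P - Q)) (2 * w - 2 * Real.pi)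
  have hn : ‖(2⁻¹ : ℝ) • (P - Q)‖ = dist P Q / 2 := by
    rw [norm_smul, dist_eq_norm, Real.norm_of_nonneg (by norm_num)]; ring
  rw [hn] at c0 c1
  simp only [PiLp.smul_apply, PiLp.sub_apply, smul_eq_mul, midpoint_eq_smul_add, PiLp.add_apply,
    invOf_eq_inv] at c0 c1 h0 h1
  have f : IsFrame o P Q R w (θ / 2) (dist P Q / 2) := by
    refine ⟨by positivity, hR, ?_, ?_, ?_, ?_⟩ <;> rw [mul_div_cancel₀ θ two_ne_zero] <;> linarith
  rcases lt_or_ge (w - θ / 2) (Real.pi / 2) with hlt | hge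
  · exact ⟨θ / 2, _, by linarith, hlt, Or.inl f⟩
  · exact ⟨θ / 2 + Real.pi / 2, _, by linarith, by linarith, Or.inr f.flip⟩

/-- Edges of a max-sum matching whose disks miss `o` are not seen from `o` in directions that
positively span the plane in counterclockwise order. -/
theorem false_of_cross_pos {m : ℕ} {x : Fin m → Pt} {σ : Equiv.Perm (Fin m)}
    (h : IsMaxSumMatching x σ) {i j k : Fin m} (hij : j ≠ i) (hij' : j ≠ σ i)
    (hjk : k ≠ j) (hjk' : k ≠ σ j) (hki : i ≠ k) (hki' : i ≠ σ k) {o v₁ v₂ v₃ : Pt}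
    (hv₁ : midpoint ℝ (x i) (x (σ i)) - o = v₁) (hv₂ : midpoint ℝ (x j) (x (σ j)) - o = v₂)
    (hv₃ : midpoint ℝ (x k) (x (σ k)) - o = v₃) (hr₁ : dist (x i) (x (σ i)) / 2 < ‖v₁‖)
    (hr₂ : dist (x j) (x (σ j)) / 2 < ‖v₂‖) (hr₃ : dist (x k) (x (σ k)) / 2 < ‖v₃‖)
    (c₁ : 0 < v₁ 0 * v₂ 1 - v₁ 1 * v₂ 0) (c₂ : 0 < v₂ 0 * v₃ 1 - v₂ 1 * v₃ 0)
    (c₃ : 0 < v₃ 0 * v₁ 1 - v₃ 1 * v₁ 0) : False := by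
  obtain ⟨θ₁, -, -, p₁, q₁⟩ := exists_polar v₁ 0
  obtain ⟨θ₂, l₂, u₂, p₂, q₂⟩ := exists_polar v₂ θ₁
  obtain ⟨θ₃, l₃, u₃, p₃, q₃⟩ := exists_polar v₃ θ₂
  have sin_pos : ∀ {v w : Pt} {α β : ℝ}, v 0 = ‖v‖ * Real.cos α → v 1 = ‖v‖ * Real.sin α →
      w 0 = ‖w‖ * Real.cos β → w 1 = ‖w‖ * Real.sin β → 0 < v 0 * w 1 - v 1 * w 0 →
      0 < Real.sin (β - α) := by
    intro v w α β hv0 hv1 hw0 hw1 hc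
    have e : v 0 * w 1 - v 1 * w 0 = (‖v‖ * ‖w‖) * Real.sin (β - α) := by
      rw [hv0, hv1, hw0, hw1, Real.sin_sub]; ring
    rw [e] at hc
    by_contra! hs
    exact hc.not_ge (mul_nonpos_of_nonneg_of_nonpos (by positivity) hs)
  have lt_pi : ∀ {α : ℝ}, 0 < Real.sin α → α ≤ 2 * Real.pi → α < Real.pi := by
    intro α hα hle
    by_contra! hge
    have := Real.sin_nonneg_of_nonneg_of_le_pi (x := α - Real.pi) (by linarith) (by linarith)
    rw [Real.sin_sub_pi] at this
    linarith
  have d₁ := lt_pi (sin_pos p₁ q₁ p₂ q₂ c₁) (by linarith)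
  have d₂ := lt_pi (sin_pos p₂ q₂ p₃ q₃ c₂) (by linarith)
  have d₃ : Real.pi < θ₃ - θ₁ := by
    by_contra! hle
    have h₁ := sin_pos p₃ q₃ p₁ q₁ c₃
    have h₂ := Real.sin_nonneg_of_nonneg_of_le_pi (x := θ₃ - θ₁) (by linarith) hle
    rw [← neg_sub, Real.sin_neg] at h₁
    linarith
  have frame : ∀ {a : Fin m} {v : Pt} {θ : ℝ}, midpoint ℝ (x a) (x (σ a)) - o = v →
      dist (x a) (x (σ a)) / 2 < ‖v‖ → v 0 = ‖v‖ * Real.cos θ → v 1 = ‖v‖ * Real.sin θ →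
      ∃ b, (b = a ∨ b = σ a) ∧ ∃ u r, 0 ≤ θ / 2 - u ∧ θ / 2 - u < Real.pi / 2 ∧
        IsFrame o (x b) (x (σ b)) ‖v‖ (θ / 2) u r := by
    intro a v θ hv hr h0 h1
    subst hv
    obtain ⟨u, r, hu, hu', f | f⟩ := exists_isFrame (w := θ / 2) hr
      (by rwa [mul_div_cancel₀ θ two_ne_zero]) (by rwa [mul_div_cancel₀ θ two_ne_zero])
    · exact ⟨a, Or.inl rfl, u, r, hu, hu', f⟩
    · exact ⟨σ a, Or.inr rfl, u, r, hu, hu', by rwa [(h.1 a).2]⟩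
  obtain ⟨a, ha, _, _, a₁, b₁, f₁⟩ := frame hv₁ hr₁ p₁ q₁
  obtain ⟨b, hb, _, _, a₂, b₂, f₂⟩ := frame hv₂ hr₂ p₂ q₂
  obtain ⟨c, hc, _, _, a₃, b₃, f₃⟩ := frame hv₃ hr₃ p₃ q₃
  have apart : ∀ {a b c d : Fin m}, b ≠ a → b ≠ σ a → (c = a ∨ c = σ a) → (d = b ∨ d = σ b) →
      d ≠ c ∧ d ≠ σ c := by
    intro a b c d h₁ h₂ hc hd
    have h₃ : σ b ≠ σ a := σ.injective.ne h₁
    have h₄ : σ b ≠ a := fun e => h₂ (by rw [← e, (h.1 b).2])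
    rcases hc with rfl | rfl <;> rcases hd with rfl | rfl <;> constructor <;>
      first | assumption | rwa [(h.1 _).2]
  obtain ⟨n₁, n₁'⟩ := apart hij hij' ha hb
  obtain ⟨n₂, n₂'⟩ := apart hjk hjk' hb hc
  obtain ⟨n₃, n₃'⟩ := apart hki hki' hc ha
  exact false_of_frames f₁ f₂ f₃ a₁ a₂ a₃ b₁ b₂ b₃ (by linarith) (by linarith) (by linarith)
    (by linarith) (by linarith) (by linarith) (dist_swap_apply_le h n₁ n₁') (dist_swap_apply_le h n₂ n₂') (dist_swap_apply_le h n₃ n₃')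
    (dist_cycle_le h n₁ n₁' n₂ n₂' n₃ n₃')

/-- If finitely many balls have no common point, then some convex combination of the centers
misses every ball whose center has positive weight. -/
theorem exists_mem_closedBall_or_exists_weights {E ι : Type*} [NormedAddCommGroup E]
    [InnerProductSpace ℝ E] [Fintype ι] [Nonempty ι] (c : ι → E) (r : ι → ℝ) (hr : ∀ k, 0 ≤ r k) :
    (∃ o, ∀ k, o ∈ Metric.closedBall (c k) (r k)) ∨
      ∃ (o : E) (l : ι → ℝ), (∀ k, 0 ≤ l k) ∧ ∑ k, l k = 1 ∧ ∑ k, l k • (c k - o) = 0 ∧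
        ∀ k, 0 < l k → r k < ‖c k - o‖ := by
  classical
  set φ : (ι → ℝ) → ℝ := fun l =>
    ∑ k, l k * (‖c k‖ ^ 2 - r k ^ 2) - ‖∑ k, l k • c k‖ ^ 2 with hφ
  obtain ⟨l, hl, hmax⟩ := (isCompact_stdSimplex ℝ ι).exists_isMaxOn
    ⟨_, single_mem_stdSimplex ℝ (Classical.arbitrary ι)⟩
    (f := φ) (by fun_prop)
  set o := ∑ k, l k • c k with ho
  have hle : ∀ j, ‖c j - o‖ ^ 2 - r j ^ 2 ≤ φ l := by
    intro j
    have key : ∀ t : ℝ, 0 ≤ t → t ≤ 1 →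
        t * (‖c j - o‖ ^ 2 - r j ^ 2 - φ l) ≤ t ^ 2 * ‖c j - o‖ ^ 2 := by
      intro t ht ht'
      have hmem : (1 - t) • l + t • (Pi.single j 1 : ι → ℝ) ∈ stdSimplex ℝ ι :=
        convex_stdSimplex ℝ ι hl (single_mem_stdSimplex ℝ j) (sub_nonneg.2 ht') ht (by ring)
      have h1 : φ ((1 - t) • l + t • (Pi.single j 1 : ι → ℝ)) ≤ φ l := hmax hmem
      have h2 : ∑ k, ((1 - t) • l + t • (Pi.single j 1 : ι → ℝ)) k • c k = o + t • (c j - o) := by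
        simp only [Pi.add_apply, Pi.smul_apply, smul_eq_mul, add_smul, mul_smul,
          Finset.sum_add_distrib, ← Finset.smul_sum, Pi.single_apply, ite_smul, one_smul,
          zero_smul, Finset.sum_ite_eq', Finset.mem_univ, if_true, ← ho]
        module
      have h3 : ∑ k, ((1 - t) • l + t • (Pi.single j 1 : ι → ℝ)) k * (‖c k‖ ^ 2 - r k ^ 2) =
          (1 - t) * ∑ k, l k * (‖c k‖ ^ 2 - r k ^ 2) + t * (‖c j‖ ^ 2 - r j ^ 2) := by
        simp only [Pi.add_apply, Pi.smul_apply, smul_eq_mul, add_mul, mul_assoc,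
          Finset.sum_add_distrib, ← Finset.mul_sum, Pi.single_apply, ite_mul, one_mul,
          zero_mul, Finset.sum_ite_eq', Finset.mem_univ, if_true]
      simp only [hφ] at h1 ⊢
      rw [h2, h3, ← ho] at h1
      rw [norm_add_sq_real, norm_smul, real_inner_smul_right, inner_sub_right,
        real_inner_self_eq_norm_sq, mul_pow, Real.norm_eq_abs, sq_abs] at h1
      have h4 := norm_sub_sq_real (c j) o
      rw [real_inner_comm] at h4
      have h5 := congrArg (t * ·) h4
      linarith
    by_contra! hlt
    set δ := ‖c j - o‖ ^ 2 - r j ^ 2 - φ l with hδ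
    have hδ0 : 0 < δ := sub_pos.2 hlt
    have hD := sq_nonneg ‖c j - o‖
    have hs : 0 < ‖c j - o‖ ^ 2 + δ := by linarith
    have := key (δ / (‖c j - o‖ ^ 2 + δ)) (by positivity) ((div_le_one hs).2 (by linarith))
    field_simp at this
    linarith
  have hzero : ∑ k, l k • (c k - o) = 0 := by
    simp only [smul_sub, Finset.sum_sub_distrib, ← Finset.sum_smul, hl.2, one_smul, ← ho, sub_self]
  rcases le_or_gt (φ l) 0 with hneg | hpos
  · refine Or.inl ⟨o, fun k => ?_⟩
    rw [Metric.mem_closedBall', dist_eq_norm]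
    exact (pow_le_pow_iff_left₀ (norm_nonneg _) (hr k) two_ne_zero).1
      (by linarith [hle k])
  · refine Or.inr ⟨o, l, hl.1, hl.2, hzero, fun k hk => ?_⟩
    have hsum : ∑ k, l k * (φ l - (‖c k - o‖ ^ 2 - r k ^ 2)) = 0 := by
      have hk : ∀ k, l k * (φ l - (‖c k - o‖ ^ 2 - r k ^ 2)) =
          l k * (φ l - ‖o‖ ^ 2) - l k * (‖c k‖ ^ 2 - r k ^ 2) + 2 * inner ℝ (l k • c k) o := by
        intro k
        rw [norm_sub_sq_real, real_inner_smul_left]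
        ring
      rw [Finset.sum_congr rfl fun k _ => hk k, Finset.sum_add_distrib, Finset.sum_sub_distrib,
        ← Finset.sum_mul, hl.2, ← Finset.mul_sum, ← sum_inner, ← ho, real_inner_self_eq_norm_sq]
      simp only [hφ, ← ho]
      ring
    have h0 := (Finset.sum_eq_zero_iff_of_nonneg fun k _ =>
      mul_nonneg (hl.1 k) (sub_nonneg.2 (hle k))).1 hsum k (Finset.mem_univ k)
    have h1 := (mul_eq_zero.1 h0).resolve_left hk.ne'
    exact lt_of_pow_lt_pow_left₀ 2 (norm_nonneg _) (by linarith)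

section Weights

variable {m : ℕ} {x : Fin m → Pt} {σ : Equiv.Perm (Fin m)} {o : Pt}

theorem false_of_opposite (h : IsMaxSumMatching x σ) {i j : Fin m} {v w : Pt}
    (hv : midpoint ℝ (x i) (x (σ i)) - o = v) (hw : midpoint ℝ (x j) (x (σ j)) - o = w)
    {a b : ℝ} (ha : 0 ≤ a) (hb : 0 ≤ b) (hab : 0 < a + b) (h0 : a • v + b • w = 0)
    (hrv : 0 < a → dist (x i) (x (σ i)) / 2 < ‖v‖)
    (hrw : 0 < b → dist (x j) (x (σ j)) / 2 < ‖w‖) : False := by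
  have ne : ∀ {p q : Pt} {u : Pt}, dist p q / 2 < ‖u‖ → u ≠ 0 := by
    rintro p q _ hu rfl
    rw [norm_zero] at hu
    linarith [dist_nonneg (x := p) (y := q)]
  rcases ha.eq_or_lt with rfl | ha
  · rw [zero_add] at hab
    rw [zero_smul, zero_add] at h0
    exact ne (hrw hab) ((smul_eq_zero.1 h0).resolve_left hab.ne')
  rcases hb.eq_or_lt with rfl | hb
  · rw [zero_smul, add_zero] at h0
    exact ne (hrv ha) ((smul_eq_zero.1 h0).resolve_left ha.ne')
  by_cases hij : j = i ∨ j = σ i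
  · have hvw : w = v := by
      rcases hij with rfl | rfl
      · rw [← hv, hw]
      · rw [← hv, ← hw, (h.1 i).2, midpoint_comm]
    rw [hvw, ← add_smul] at h0
    exact ne (hrv ha) ((smul_eq_zero.1 h0).resolve_left hab.ne')
  · rw [not_or] at hij
    have hs : SameRay ℝ v (-w) :=
      Or.inr (Or.inr ⟨a, b, ha, hb, by rw [smul_neg]; exact eq_neg_of_add_eq_zero_left h0⟩)
    have hn := hs.norm_add
    have hd := dist_midpoint_midpoint_le (V := Pt) (x i) (x (σ i)) (x j) (x (σ j))
    rw [dist_eq_norm, ← sub_sub_sub_cancel_right _ _ o, hv, hw, sub_eq_add_neg, hn, norm_neg] at hd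
    linarith [dist_swap_apply_le h hij.1 hij.2, hrv ha, hrw hb]

theorem false_of_weights_of_cross_pos (h : IsMaxSumMatching x σ) {i j k : Fin m} {v₁ v₂ v₃ : Pt}
    (hv₁ : midpoint ℝ (x i) (x (σ i)) - o = v₁) (hv₂ : midpoint ℝ (x j) (x (σ j)) - o = v₂)
    (hv₃ : midpoint ℝ (x k) (x (σ k)) - o = v₃) (hr₁ : dist (x i) (x (σ i)) / 2 < ‖v₁‖)
    (hr₂ : dist (x j) (x (σ j)) / 2 < ‖v₂‖) (hr₃ : dist (x k) (x (σ k)) / 2 < ‖v₃‖)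
    {a b c : ℝ} (ha : 0 < a) (hb : 0 < b) (hc : 0 < c) (h0 : a • v₁ + b • v₂ + c • v₃ = 0)
    (hcross : 0 < v₁ 0 * v₂ 1 - v₁ 1 * v₂ 0) : False := by
  have z0 := congrArg (fun v : Pt => v 0) h0
  have z1 := congrArg (fun v : Pt => v 1) h0
  simp only [PiLp.add_apply, PiLp.smul_apply, smul_eq_mul, PiLp.zero_apply] at z0 z1
  have e₁ : c * (v₂ 0 * v₃ 1 - v₂ 1 * v₃ 0) = a * (v₁ 0 * v₂ 1 - v₁ 1 * v₂ 0) := by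
    linear_combination v₂ 0 * z1 - v₂ 1 * z0
  have e₂ : c * (v₃ 0 * v₁ 1 - v₃ 1 * v₁ 0) = b * (v₁ 0 * v₂ 1 - v₁ 1 * v₂ 0) := by
    linear_combination v₁ 1 * z0 - v₁ 0 * z1
  have c₂ := pos_of_mul_pos_right (e₁ ▸ mul_pos ha hcross) hc.le
  have c₃ := pos_of_mul_pos_right (e₂ ▸ mul_pos hb hcross) hc.le
  have ne : ∀ {p q : Fin m} {v w : Pt}, midpoint ℝ (x p) (x (σ p)) - o = v →
      midpoint ℝ (x q) (x (σ q)) - o = w → 0 < v 0 * w 1 - v 1 * w 0 → q ≠ p ∧ q ≠ σ p := by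
    rintro p q v w hv hw hc
    constructor
    · rintro rfl
      rw [← hv, hw] at hc
      linarith
    · rintro rfl
      rw [(h.1 p).2, midpoint_comm, hv] at hw
      rw [hw] at hc
      linarith
  exact false_of_cross_pos h (ne hv₁ hv₂ hcross).1 (ne hv₁ hv₂ hcross).2 (ne hv₂ hv₃ c₂).1
    (ne hv₂ hv₃ c₂).2 (ne hv₃ hv₁ c₃).1 (ne hv₃ hv₁ c₃).2 hv₁ hv₂ hv₃ hr₁ hr₂ hr₃ hcross c₂ c₃

theorem false_of_weights (h : IsMaxSumMatching x σ) {i j k : Fin m} {v₁ v₂ v₃ : Pt}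
    (hv₁ : midpoint ℝ (x i) (x (σ i)) - o = v₁) (hv₂ : midpoint ℝ (x j) (x (σ j)) - o = v₂)
    (hv₃ : midpoint ℝ (x k) (x (σ k)) - o = v₃)
    {a b c : ℝ} (ha : 0 ≤ a) (hb : 0 ≤ b) (hc : 0 ≤ c) (habc : a + b + c = 1)
    (h0 : a • v₁ + b • v₂ + c • v₃ = 0)
    (hr₁ : 0 < a → dist (x i) (x (σ i)) / 2 < ‖v₁‖)
    (hr₂ : 0 < b → dist (x j) (x (σ j)) / 2 < ‖v₂‖)
    (hr₃ : 0 < c → dist (x k) (x (σ k)) / 2 < ‖v₃‖) : False := by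
  rcases ha.eq_or_lt with rfl | ha
  · exact false_of_opposite h hv₂ hv₃ hb hc (by linarith) (by simpa using h0) hr₂ hr₃
  rcases hb.eq_or_lt with rfl | hb
  · exact false_of_opposite h hv₁ hv₃ ha.le hc (by linarith) (by simpa using h0) hr₁ hr₃
  rcases hc.eq_or_lt with rfl | hc
  · exact false_of_opposite h hv₁ hv₂ ha.le hb.le (by linarith) (by simpa using h0) hr₁ hr₂
  rcases lt_trichotomy (v₁ 0 * v₂ 1 - v₁ 1 * v₂ 0) 0 with hneg | hzero | hpos
  · exact false_of_weights_of_cross_pos h hv₂ hv₁ hv₃ (hr₂ hb) (hr₁ ha) (hr₃ hc) hb ha hc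
      (by rw [← h0]; abel) (by linarith)
  · have hn : 0 < ‖v₁‖ := lt_of_le_of_lt (by positivity) (hr₁ ha)
    have hpar : (‖v₁‖ ^ 2) • v₂ = (v₁ 0 * v₂ 0 + v₁ 1 * v₂ 1) • v₁ := by
      rw [EuclideanSpace.norm_sq_eq, Fin.sum_univ_two, Real.norm_eq_abs, Real.norm_eq_abs, sq_abs,
        sq_abs]
      ext s
      fin_cases s <;> simp only [PiLp.smul_apply, smul_eq_mul, Fin.zero_eta, Fin.mk_one]
      · linear_combination -v₁ 1 * hzero
      · linear_combination v₁ 0 * hzero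
    rcases lt_or_ge (v₁ 0 * v₂ 0 + v₁ 1 * v₂ 1) 0 with hd | hd
    · exact false_of_opposite h hv₁ hv₂ (neg_pos.2 hd).le (sq_nonneg ‖v₁‖)
        (by linarith [pow_pos hn 2])
        (by rw [hpar, neg_smul, neg_add_cancel]) (fun _ => hr₁ ha) (fun _ => hr₂ hb)
    · refine false_of_opposite h hv₁ hv₃ (a := ‖v₁‖ ^ 2 * a + b * (v₁ 0 * v₂ 0 + v₁ 1 * v₂ 1))
        (b := ‖v₁‖ ^ 2 * c) (by positivity) (by positivity) (by positivity) ?_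
        (fun _ => hr₁ ha) (fun _ => hr₃ hc)
      have := congrArg (fun v => ‖v₁‖ ^ 2 • v) h0
      simp only [smul_add, smul_zero] at this
      rw [smul_comm _ b v₂, hpar] at this
      rw [← this]
      module
  · exact false_of_weights_of_cross_pos h hv₁ hv₂ hv₃ (hr₁ ha) (hr₂ hb) (hr₃ hc) ha hb hc h0 hpos

theorem exists_mem_three_disks (h : IsMaxSumMatching x σ) (i j k : Fin m) :
    ∃ o, o ∈ disk (x i) (x (σ i)) ∧ o ∈ disk (x j) (x (σ j)) ∧ o ∈ disk (x k) (x (σ k)) := by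
  obtain ⟨o, ho⟩ | ⟨o, l, hl, hsum, h0, hr⟩ := exists_mem_closedBall_or_exists_weights
    (fun s : Fin 3 => midpoint ℝ (x (![i, j, k] s)) (x (σ (![i, j, k] s))))
    (fun s => dist (x (![i, j, k] s)) (x (σ (![i, j, k] s))) / 2) (fun s => by positivity)
  · exact ⟨o, ho 0, ho 1, ho 2⟩
  · rw [Fin.sum_univ_three] at hsum h0
    exact (false_of_weights h rfl rfl rfl (hl 0) (hl 1) (hl 2) hsum h0 (hr 0) (hr 1) (hr 2)).elim

end Weights

/-- Main theorem: all disks of a max-sum matching of 2n points have a common point. -/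
theorem stmt17 (n : ℕ) (hn : 1 ≤ n) (x : Fin (2 * n) → Pt) (σ : Equiv.Perm (Fin (2 * n)))
    (hmax : IsMaxSumMatching x σ) :
    ∃ o : Pt, ∀ i, o ∈ disk (x i) (x (σ i)) := by
  have hfin : Module.finrank ℝ Pt + 1 = 3 := by simp
  obtain ⟨o, ho⟩ := Convex.helly_theorem' (𝕜 := ℝ) (s := Finset.univ)
    (F := fun i => disk (x i) (x (σ i))) (fun i _ => convex_closedBall _ _) (by
      intro I _ hI
      rw [hfin] at hI
      have hsub : ∃ i j k, I ⊆ {i, j, k} := by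
        have i₀ : Fin (2 * n) := ⟨0, by omega⟩
        have hc : I.card = 0 ∨ I.card = 1 ∨ I.card = 2 ∨ I.card = 3 := by omega
        rcases hc with hc | hc | hc | hc
        · exact ⟨i₀, i₀, i₀, by simp [Finset.card_eq_zero.1 hc]⟩
        · obtain ⟨i, rfl⟩ := Finset.card_eq_one.1 hc
          exact ⟨i, i, i, by simp⟩
        · obtain ⟨i, j, -, rfl⟩ := Finset.card_eq_two.1 hc
          exact ⟨i, j, j, by simp⟩
        · obtain ⟨i, j, k, -, -, -, rfl⟩ := Finset.card_eq_three.1 hc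
          exact ⟨i, j, k, subset_rfl⟩
      obtain ⟨i, j, k, hijk⟩ := hsub
      obtain ⟨o, hi, hj, hk⟩ := exists_mem_three_disks hmax i j k
      refine ⟨o, Set.mem_iInter₂.2 fun b hb => ?_⟩
      have hb' := hijk hb
      simp only [Finset.mem_insert, Finset.mem_singleton] at hb'
      rcases hb' with rfl | rfl | rfl <;> assumption)
  exact ⟨o, fun i => Set.mem_iInter₂.1 ho i (Finset.mem_univ i)⟩
end
end

section
/- Let P be a set of 2n (uncolored) points in the plane and let {(a_i,b_i) : i = 1,…,n} be a max-sum matching of P. Then there exists a point o of the plane such that for all i ∈ {1,…,n}, ‖a_i−o‖ + ‖b_i−o‖ ≤ √2 · ‖a_i−b_i‖. -/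
noncomputable section

open Real Filter Topology

section Descent

variable {E : Type*} [NormedAddCommGroup E] [InnerProductSpace ℝ E]

theorem hasDerivAt_norm_sub_add_smul {a o : E} (h : a ≠ o) (v : E) :
    HasDerivAt (fun t : ℝ => ‖a - (o + t • v)‖) (-(inner ℝ (a - o) v / ‖a - o‖)) 0 := by
  have hpos : 0 < ‖a - o‖ := norm_pos_iff.2 (sub_ne_zero.2 h)
  have h1 : HasDerivAt (fun t : ℝ => a - (o + t • v)) (-v) 0 := by
    simpa using (((hasDerivAt_id (0 : ℝ)).smul_const v).const_add o).const_sub a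
  have h2 := h1.norm_sq.sqrt (by simpa using hpos.ne')
  simp only [norm_nonneg, Real.sqrt_sq, zero_smul, add_zero, inner_neg_right] at h2
  convert h2 using 1
  field_simp

theorem eventually_lt_of_hasDerivAt_neg {f : ℝ → ℝ} {f' x : ℝ} (hf : HasDerivAt f f' x)
    (hneg : f' < 0) : ∀ᶠ t in 𝓝[>] x, f t < f x := by
  have h := (hasDerivWithinAt_iff_tendsto_slope' (s := Set.Ioi x) (lt_irrefl x)).1
    hf.hasDerivWithinAt
  filter_upwards [h.eventually_lt_const hneg, self_mem_nhdsWithin] with t ht hxt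
  rw [slope_def_field, div_lt_iff₀ (sub_pos.2 hxt)] at ht
  linarith

/-- First-order optimality at a minimizer of the maximum of the functions
`p ↦ ‖a i - p‖ + ‖b i - p‖ - c i`. -/
theorem exists_minimizer_sum_dist [ProperSpace E] {ι : Type*} [Fintype ι] [Nonempty ι]
    (a b : ι → E) (c : ι → ℝ) :
    ∃ (o : E) (M : ℝ), (∀ i, ‖a i - o‖ + ‖b i - o‖ - c i ≤ M) ∧
      ∀ v : E, ∃ i, ‖a i - o‖ + ‖b i - o‖ - c i = M ∧ (a i ≠ o → b i ≠ o →
        inner ℝ (a i - o) v / ‖a i - o‖ + inner ℝ (b i - o) v / ‖b i - o‖ ≤ 0) := by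
  classical
  let f : ι → E → ℝ := fun i p => ‖a i - p‖ + ‖b i - p‖ - c i
  let F : E → ℝ := fun p => Finset.univ.sup' Finset.univ_nonempty (fun i => f i p)
  have hf : ∀ i, Continuous (f i) := fun i => by fun_prop
  have hF : Continuous F := Continuous.finset_sup'_apply _ (fun i _ => hf i)
  have hle : ∀ i p, f i p ≤ F p := fun i p =>
    Finset.le_sup' (fun i => f i p) (Finset.mem_univ i)
  obtain ⟨i₀⟩ := ‹Nonempty ι›
  have hlim : Tendsto F (cocompact E) atTop := by
    refine tendsto_atTop_mono (f := fun p => dist (a i₀) p - c i₀) (fun p => ?_)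
      (tendsto_atTop_add_const_right _ _ (tendsto_dist_left_cocompact_atTop (a i₀)))
    refine le_trans ?_ (hle i₀ p)
    simp only [f, dist_eq_norm]
    linarith [norm_nonneg (b i₀ - p)]
  obtain ⟨o, ho⟩ := hF.exists_forall_le hlim
  refine ⟨o, F o, fun i => hle i o, fun v => ?_⟩
  by_contra! hcon
  have hev : ∀ i, ∀ᶠ t : ℝ in 𝓝[>] 0, f i (o + t • v) < F o := by
    intro i
    rcases (hle i o).lt_or_eq with hlt | heq
    · have hc : Continuous fun t : ℝ => f i (o + t • v) := by fun_prop
      have : Tendsto (fun t : ℝ => f i (o + t • v)) (𝓝 0) (𝓝 (f i o)) := by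
        simpa using hc.tendsto 0
      exact (this.mono_left nhdsWithin_le_nhds).eventually_lt_const hlt
    · obtain ⟨ha, hb, hd⟩ := hcon i heq
      have hder := ((hasDerivAt_norm_sub_add_smul ha v).add
        (hasDerivAt_norm_sub_add_smul hb v)).sub_const (c i)
      have := eventually_lt_of_hasDerivAt_neg hder (by linarith)
      simpa [f, ← heq] using this
  obtain ⟨t, ht⟩ := (eventually_all.2 hev).exists
  have : F (o + t • v) < F o := (Finset.sup'_lt_iff _).2 fun i _ => ht i
  exact absurd (ho (o + t • v)) (not_le.2 this)

theorem norm_add_norm_le_sqrt_two_mul_norm_sub {u v : E} (h : inner ℝ u v ≤ 0) :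
    ‖u‖ + ‖v‖ ≤ √2 * ‖u - v‖ := by
  have h1 := norm_sub_sq_real u v
  refine abs_le_of_sq_le_sq' ?_ (by positivity) |>.2
  rw [mul_pow, Real.sq_sqrt (by norm_num), h1]
  nlinarith [sq_nonneg (‖u‖ - ‖v‖)]

end Descent

theorem exists_int_add_mem_Icc_of_cos_nonpos {t : ℝ} (h : cos t ≤ 0) :
    ∃ k : ℤ, π / 2 ≤ t + k * (2 * π) ∧ t + k * (2 * π) ≤ 3 * π / 2 := by
  have hm := toIocMod_mem_Ioc Real.two_pi_pos (-(π / 2)) t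
  have he := self_sub_toIocDiv_zsmul Real.two_pi_pos (-(π / 2)) t
  set k := toIocDiv Real.two_pi_pos (-(π / 2)) t
  rw [← he, zsmul_eq_mul] at hm
  refine ⟨-k, ?_, ?_⟩
  · by_contra! hlt
    push_cast at hlt
    have := cos_pos_of_mem_Ioo (x := t - k * (2 * π)) ⟨hm.1, by linarith⟩
    rw [cos_sub_int_mul_two_pi] at this
    linarith
  · push_cast
    linarith [hm.2]

/-- The unit vector at angle `t`. -/
def unitVec (t : ℝ) : Pt := !₂[cos t, sin t]

theorem inner_unitVec (s t : ℝ) : inner ℝ (unitVec s) (unitVec t) = cos (s - t) := by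
  simp [unitVec, PiLp.inner_apply, Fin.sum_univ_two, cos_sub]
  ring

theorem norm_unitVec (t : ℝ) : ‖unitVec t‖ = 1 := by
  rw [norm_eq_sqrt_real_inner, inner_unitVec]
  simp

theorem unitVec_add_int_mul_two_pi (t : ℝ) (k : ℤ) :
    unitVec (t + k * (2 * π)) = unitVec t := by
  simp [unitVec]

theorem exists_eq_smul_unitVec {u : Pt} (hu : u ≠ 0) :
    ∃ r t : ℝ, 0 < r ∧ u = r • unitVec t := by
  have hz : (⟨u 0, u 1⟩ : ℂ) ≠ 0 := by
    intro h
    apply hu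
    ext i
    fin_cases i
    · exact congrArg Complex.re h
    · exact congrArg Complex.im h
  refine ⟨‖(⟨u 0, u 1⟩ : ℂ)‖, Complex.arg ⟨u 0, u 1⟩, norm_pos_iff.2 hz, ?_⟩
  ext i
  fin_cases i
  · simp [unitVec, Complex.norm_mul_cos_arg]
  · simp [unitVec, Complex.norm_mul_sin_arg]

/-- The vectors `u` and `v` span an angle `2 * α < π / 2` bisected by the direction `θ`, with `u`
on its counterclockwise side. -/
def SpanArc (u v : Pt) (θ α : ℝ) : Prop :=
  0 ≤ α ∧ α < π / 4 ∧ (∃ r : ℝ, 0 < r ∧ u = r • unitVec (θ + α)) ∧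
    ∃ s : ℝ, 0 < s ∧ v = s • unitVec (θ - α)

theorem SpanArc.add_int_mul_two_pi {u v : Pt} {θ α : ℝ} (h : SpanArc u v θ α) (k : ℤ) :
    SpanArc u v (θ + k * (2 * π)) α := by
  rwa [SpanArc, add_right_comm, add_sub_right_comm, unitVec_add_int_mul_two_pi,
    unitVec_add_int_mul_two_pi]

theorem exists_spanArc {u v : Pt} (h : 0 < inner ℝ u v) :
    ∃ θ α, SpanArc u v θ α ∨ SpanArc v u θ α := by
  have hu : u ≠ 0 := by rintro rfl; simp at h
  have hv : v ≠ 0 := by rintro rfl; simp at h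
  obtain ⟨r, s, hr, rfl⟩ := exists_eq_smul_unitVec hu
  obtain ⟨q, t, hq, rfl⟩ := exists_eq_smul_unitVec hv
  rw [real_inner_smul_left, real_inner_smul_right, inner_unitVec] at h
  have hcos : 0 < cos (s - t) := pos_of_mul_pos_right (pos_of_mul_pos_right h hr.le) hq.le
  obtain ⟨k, hk1, hk2⟩ := exists_int_add_mem_Icc_of_cos_nonpos (t := s - t + π)
    (by rw [cos_add_pi]; linarith)
  have hk : cos (s + k * (2 * π) - t) = cos (s - t) := by
    rw [add_sub_right_comm, cos_add_int_mul_two_pi]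
  rw [← unitVec_add_int_mul_two_pi s k]
  generalize hs : s + k * (2 * π) = s' at *
  have h1 : s' - t ≠ π / 2 := by
    intro h0; rw [h0, cos_pi_div_two] at hk; linarith
  have h2 : s' - t ≠ -(π / 2) := by
    intro h0; rw [h0, cos_neg, cos_pi_div_two] at hk; linarith
  have h1' : s' - t < π / 2 := lt_of_le_of_ne (by linarith) h1
  have h2' : -(π / 2) < s' - t := lt_of_le_of_ne (by linarith) h2.symm
  rcases le_total t s' with hts | hts
  · refine ⟨(s' + t) / 2, (s' - t) / 2, Or.inl ⟨by linarith, by linarith,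
      ⟨r, hr, by congr 2; ring⟩, ⟨q, hq, by congr 2; ring⟩⟩⟩
  · refine ⟨(s' + t) / 2, (t - s') / 2, Or.inr ⟨by linarith, by linarith,
      ⟨q, hq, by congr 2; ring⟩, ⟨r, hr, by congr 2; ring⟩⟩⟩

theorem inner_smul_unitVec_nonpos {r q s t : ℝ} (hr : 0 < r) (hq : 0 < q)
    (h1 : π / 2 ≤ s - t) (h2 : s - t ≤ 3 * π / 2) :
    inner ℝ (r • unitVec s) (q • unitVec t) ≤ 0 := by
  rw [real_inner_smul_left, real_inner_smul_right, inner_unitVec]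
  have := cos_nonpos_of_pi_div_two_le_of_le h1 (by linarith)
  exact mul_nonpos_of_nonneg_of_nonpos hr.le (mul_nonpos_of_nonneg_of_nonpos hq.le this)

theorem SpanArc.inner_nonpos_of_opposite {u v u' v' : Pt} {θ α θ' α' : ℝ} (h : SpanArc u v θ α)
    (h' : SpanArc u' v' θ' α') (h1 : 3 * π / 4 ≤ θ' - θ) (h2 : θ' - θ ≤ 5 * π / 4) :
    inner ℝ u' u ≤ 0 ∧ inner ℝ v' v ≤ 0 := by
  obtain ⟨h0, h3, ⟨r, hr, rfl⟩, ⟨s, hs, rfl⟩⟩ := h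
  obtain ⟨h0', h3', ⟨r', hr', rfl⟩, ⟨s', hs', rfl⟩⟩ := h'
  exact ⟨inner_smul_unitVec_nonpos hr' hr (by linarith) (by linarith),
    inner_smul_unitVec_nonpos hs' hs (by linarith) (by linarith)⟩

theorem SpanArc.inner_nonpos_of_next {u v u' v' : Pt} {θ α θ' α' : ℝ} (h : SpanArc u v θ α)
    (h' : SpanArc u' v' θ' α') (h1 : π / 2 ≤ θ' - θ) (h2 : θ' - θ ≤ 3 * π / 4) :
    inner ℝ u' v ≤ 0 := by
  obtain ⟨h0, h3, ⟨r, hr, rfl⟩, ⟨s, hs, rfl⟩⟩ := h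
  obtain ⟨h0', h3', ⟨r', hr', rfl⟩, ⟨s', hs', rfl⟩⟩ := h'
  exact inner_smul_unitVec_nonpos hr' hs (by linarith) (by linarith)

theorem SpanArc.inner_div_norm_add {u v : Pt} {θ α : ℝ} (h : SpanArc u v θ α) (φ : ℝ) :
    inner ℝ u (unitVec φ) / ‖u‖ + inner ℝ v (unitVec φ) / ‖v‖ = 2 * cos α * cos (θ - φ) := by
  obtain ⟨-, -, ⟨r, hr, rfl⟩, ⟨s, hs, rfl⟩⟩ := h
  rw [real_inner_smul_left, real_inner_smul_left, inner_unitVec, inner_unitVec, norm_smul,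
    norm_smul, norm_unitVec, norm_unitVec, norm_of_nonneg hr.le, norm_of_nonneg hs.le,
    mul_one, mul_one, mul_div_cancel_left₀ _ hr.ne', mul_div_cancel_left₀ _ hs.ne',
    show θ + α - φ = (θ - φ) + α by ring, show θ - α - φ = (θ - φ) - α by ring,
    cos_add (θ - φ) α, cos_sub (θ - φ) α]
  ring

/-- A nonempty family of angles meeting every closed half circle, and with no two of its members
at distance at least `3π/4` on the circle, has three members cyclically separated by gaps between
`π/2` and `3π/4`. -/
theorem exists_three_angles {P : ℝ → Prop} (hper : ∀ θ (k : ℤ), P θ → P (θ + k * (2 * π)))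
    (hhalf : ∀ φ, ∃ θ, P θ ∧ cos (θ - φ) ≤ 0)
    (hopp : ∀ θ θ', P θ → P θ' → 3 * π / 4 ≤ θ' - θ → θ' - θ ≤ 5 * π / 4 → False) :
    ∃ θ₁ θ₂ θ₃, P θ₁ ∧ P θ₂ ∧ P θ₃ ∧ π / 2 ≤ θ₂ - θ₁ ∧ θ₂ - θ₁ ≤ 3 * π / 4 ∧
      π / 2 ≤ θ₃ - θ₂ ∧ θ₃ - θ₂ ≤ 3 * π / 4 ∧
      π / 2 ≤ θ₁ + 2 * π - θ₃ ∧ θ₁ + 2 * π - θ₃ ≤ 3 * π / 4 := by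
  have hhalf' : ∀ φ, ∃ θ, P θ ∧ π / 2 ≤ θ - φ ∧ θ - φ ≤ 3 * π / 2 := by
    intro φ
    obtain ⟨θ, hθ, hc⟩ := hhalf φ
    obtain ⟨k, hk⟩ := exists_int_add_mem_Icc_of_cos_nonpos hc
    exact ⟨θ + k * (2 * π), hper _ _ hθ, by rwa [add_sub_right_comm]⟩
  have hπ := Real.pi_pos
  have htwo : ∃ θ₁ θ₂, P θ₁ ∧ P θ₂ ∧ π / 2 ≤ θ₂ - θ₁ ∧ θ₂ - θ₁ < 3 * π / 4 := by
    obtain ⟨θ, hθ, -⟩ := hhalf 0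
    obtain ⟨θ', hθ', h1, h2⟩ := hhalf' θ
    rcases lt_or_ge (θ' - θ) (3 * π / 4) with h | h
    · exact ⟨θ, θ', hθ, hθ', h1, h⟩
    · have h3 : 5 * π / 4 < θ' - θ := by
        by_contra! h4
        exact hopp θ θ' hθ hθ' h h4
      refine ⟨θ', θ + (1 : ℤ) * (2 * π), hθ', hper _ _ hθ, ?_, ?_⟩ <;> push_cast <;> linarith
  obtain ⟨θ₁, θ₂, hP1, hP2, hg1, hg2⟩ := htwo
  obtain ⟨θ₃, hP3, h1, h2⟩ := hhalf' ((θ₁ + θ₂) / 2)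
  have h13 : 5 * π / 4 < θ₃ - θ₁ := by
    by_contra! h
    exact hopp θ₁ θ₃ hP1 hP3 (by linarith) h
  have h23 : θ₃ - θ₂ < 3 * π / 4 := by
    by_contra! h
    exact hopp θ₂ θ₃ hP2 hP3 h (by linarith)
  exact ⟨θ₁, θ₂, θ₃, hP1, hP2, hP3, by linarith, by linarith, by linarith, by linarith,
    by linarith, by linarith⟩

section Matching

variable {m : ℕ} {x : Fin m → Pt} {σ : Equiv.Perm (Fin m)}

theorem IsPairing.conj (h : IsPairing σ) (c : Equiv.Perm (Fin m)) :
    IsPairing (c * σ * c⁻¹) := by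
  intro i
  refine ⟨fun hi => (h (c⁻¹ i)).1 ?_, ?_⟩
  · rw [Equiv.Perm.mul_apply, Equiv.Perm.mul_apply] at hi
    rw [Equiv.Perm.eq_inv_iff_eq, hi]
  · simp [(h _).2]

theorem matchCost_conj (c : Equiv.Perm (Fin m)) :
    matchCost x (c * σ * c⁻¹) = ∑ k, dist (x (c k)) (x (c (σ k))) := by
  rw [matchCost, ← Equiv.sum_comp c]
  simp

/-- The pair of `k` violates the `√2` inequality at the point `o`. -/
def IsLong (x : Fin m → Pt) (σ : Equiv.Perm (Fin m)) (o : Pt) (k : Fin m) : Prop :=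
  √2 * dist (x k) (x (σ k)) < ‖x k - o‖ + ‖x (σ k) - o‖

theorem IsLong.inner_pos {o : Pt} {k : Fin m} (h : IsLong x σ o k) :
    0 < inner ℝ (x k - o) (x (σ k) - o) := by
  by_contra! hle
  have := norm_add_norm_le_sqrt_two_mul_norm_sub hle
  rw [sub_sub_sub_cancel_right, ← dist_eq_norm (x k)] at this
  exact absurd h (not_lt.2 this)

/-- A permutation of the points which moves only long pairs, and moves each of them to a pair seen
from `o` at an angle at least `π / 2`, contradicts maximality. -/
theorem IsMaxSumMatching.false_of_conj (hmax : IsMaxSumMatching x σ) {o : Pt}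
    (c : Equiv.Perm (Fin m))
    (hc : ∀ k, (c k = k ∧ c (σ k) = σ k) ∨
      (IsLong x σ o k ∧ inner ℝ (x (c k) - o) (x (c (σ k)) - o) ≤ 0))
    {k₀ : Fin m} (hk₀ : c k₀ ≠ k₀) : False := by
  have hle := hmax.2 _ (hmax.1.conj c)
  rw [matchCost_conj, matchCost] at hle
  let N : Fin m → ℝ := fun k => ‖x k - o‖
  have hbound : ∀ k, IsLong x σ o k → inner ℝ (x (c k) - o) (x (c (σ k)) - o) ≤ 0 →
      √2 * dist (x k) (x (σ k)) - (N k + N (σ k)) <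
        √2 * dist (x (c k)) (x (c (σ k))) - (N (c k) + N (c (σ k))) := by
    intro k hl hi
    have h1 := norm_add_norm_le_sqrt_two_mul_norm_sub hi
    rw [sub_sub_sub_cancel_right, ← dist_eq_norm (x (c k))] at h1
    have h2 : √2 * dist (x k) (x (σ k)) < N k + N (σ k) := hl
    have h3 : N (c k) + N (c (σ k)) ≤ √2 * dist (x (c k)) (x (c (σ k))) := h1
    linarith
  have hlt : ∑ k, (√2 * dist (x k) (x (σ k)) - (N k + N (σ k))) <
      ∑ k, (√2 * dist (x (c k)) (x (c (σ k))) - (N (c k) + N (c (σ k)))) := by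
    refine Finset.sum_lt_sum (fun k _ => ?_) ⟨k₀, Finset.mem_univ _, ?_⟩
    · rcases hc k with ⟨h1, h2⟩ | ⟨hl, hi⟩
      · rw [h1, h2]
      · exact (hbound k hl hi).le
    · rcases hc k₀ with ⟨h1, -⟩ | ⟨hl, hi⟩
      · exact absurd h1 hk₀
      · exact hbound k₀ hl hi
  simp only [Finset.sum_sub_distrib, Finset.sum_add_distrib, ← Finset.mul_sum] at hlt
  rw [Equiv.sum_comp σ N, Equiv.sum_comp c N, Equiv.sum_comp σ (fun k => N (c k)),
    Equiv.sum_comp c N] at hlt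
  have := mul_le_mul_of_nonneg_left hle (Real.sqrt_nonneg 2)
  linarith

theorem IsLong.symm (hσ : IsPairing σ) {o : Pt} {k : Fin m} (h : IsLong x σ o k) :
    IsLong x σ o (σ k) := by
  rw [IsLong, (hσ k).2, dist_comm, add_comm]
  exact h

theorem IsLong.ne_of_inner_nonpos {o : Pt} {i j : Fin m} (hi : IsLong x σ o i)
    (h : inner ℝ (x i - o) (x j - o) ≤ 0) : j ≠ i ∧ j ≠ σ i := by
  have hpos := hi.inner_pos
  constructor
  · rintro rfl
    have h0 : x j - o = 0 := by
      rw [real_inner_self_eq_norm_sq] at h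
      exact norm_eq_zero.1 (pow_eq_zero_iff two_ne_zero |>.1 (le_antisymm h (sq_nonneg _)))
    rw [h0] at hpos
    simp at hpos
  · rintro rfl
    linarith

theorem IsMaxSumMatching.false_of_two (hmax : IsMaxSumMatching x σ) {o : Pt} {i j : Fin m}
    (hi : IsLong x σ o i) (hj : IsLong x σ o j) (h1 : inner ℝ (x j - o) (x i - o) ≤ 0)
    (h2 : inner ℝ (x (σ j) - o) (x (σ i) - o) ≤ 0) : False := by
  have hσ := hmax.1
  obtain ⟨hij, hij'⟩ := hj.ne_of_inner_nonpos h1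
  have e1 : σ i ≠ j := by rintro rfl; exact hij' (hσ i).2.symm
  have e2 : σ i ≠ σ j := fun h => hij (σ.injective h)
  have ci : Equiv.swap (σ i) j i = i := Equiv.swap_apply_of_ne_of_ne (hσ i).1.symm hij
  have cj : Equiv.swap (σ i) j (σ j) = σ j := Equiv.swap_apply_of_ne_of_ne e2.symm (hσ j).1
  refine hmax.false_of_conj (o := o) (Equiv.swap (σ i) j) (k₀ := j) (fun k => ?_)
    (by rwa [Equiv.swap_apply_right])
  by_cases hk1 : k = i
  · subst hk1
    rw [ci, Equiv.swap_apply_left, real_inner_comm]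
    exact Or.inr ⟨hi, h1⟩
  by_cases hk2 : k = σ i
  · subst hk2
    rw [(hσ i).2, ci, Equiv.swap_apply_left]
    exact Or.inr ⟨hi.symm hσ, h1⟩
  by_cases hk3 : k = j
  · subst hk3
    rw [cj, Equiv.swap_apply_right, real_inner_comm]
    exact Or.inr ⟨hj, h2⟩
  by_cases hk4 : k = σ j
  · subst hk4
    rw [(hσ j).2, cj, Equiv.swap_apply_right]
    exact Or.inr ⟨hj.symm hσ, h2⟩
  refine Or.inl ⟨Equiv.swap_apply_of_ne_of_ne hk2 hk3, Equiv.swap_apply_of_ne_of_ne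
    (fun h => hk1 (σ.injective h)) (fun h => hk4 ?_)⟩
  rw [← h, (hσ k).2]

theorem IsMaxSumMatching.false_of_three (hmax : IsMaxSumMatching x σ) {o : Pt} {i j k : Fin m}
    (hi : IsLong x σ o i) (hj : IsLong x σ o j) (hk : IsLong x σ o k)
    (hij : inner ℝ (x j - o) (x (σ i) - o) ≤ 0) (hjk : inner ℝ (x k - o) (x (σ j) - o) ≤ 0)
    (hki : inner ℝ (x i - o) (x (σ k) - o) ≤ 0) : False := by
  have hσ := hmax.1
  obtain ⟨n1, m1⟩ := hj.ne_of_inner_nonpos hij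
  obtain ⟨n2, m2⟩ := hk.ne_of_inner_nonpos hjk
  obtain ⟨n3, m3⟩ := hi.ne_of_inner_nonpos hki
  have hne : ∀ {p q : Fin m}, σ p ≠ q → σ q ≠ p := by
    rintro p q h rfl
    exact h (hσ q).2
  have dij : i ≠ j := fun h => m1 (congrArg σ h)
  have djk : j ≠ k := fun h => m2 (congrArg σ h)
  have dki : k ≠ i := fun h => m3 (congrArg σ h)
  set c : Equiv.Perm (Fin m) := Equiv.swap i j * Equiv.swap j k with hc
  have ci : c i = j := by
    rw [hc, Equiv.Perm.mul_apply, Equiv.swap_apply_of_ne_of_ne dij dki.symm,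
      Equiv.swap_apply_left]
  have cj : c j = k := by
    rw [hc, Equiv.Perm.mul_apply, Equiv.swap_apply_left,
      Equiv.swap_apply_of_ne_of_ne dki djk.symm]
  have ck : c k = i := by
    rw [hc, Equiv.Perm.mul_apply, Equiv.swap_apply_right, Equiv.swap_apply_right]
  have cfix : ∀ q, q ≠ i → q ≠ j → q ≠ k → c q = q := by
    intro q h1 h2 h3
    rw [hc, Equiv.Perm.mul_apply, Equiv.swap_apply_of_ne_of_ne h2 h3,
      Equiv.swap_apply_of_ne_of_ne h1 h2]
  have csi : c (σ i) = σ i := cfix _ (hσ i).1 n1 (hne n3)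
  have csj : c (σ j) = σ j := cfix _ (hne n1) (hσ j).1 n2
  have csk : c (σ k) = σ k := cfix _ n3 (hne n2) (hσ k).1
  have hmem : ∀ {p q : Fin m}, IsLong x σ o p → c p = q → c (σ p) = σ p →
      inner ℝ (x q - o) (x (σ p) - o) ≤ 0 → ∀ r, r = p ∨ r = σ p →
      IsLong x σ o r ∧ inner ℝ (x (c r) - o) (x (c (σ r)) - o) ≤ 0 := by
    rintro p q hp h1 h2 h3 r (rfl | rfl)
    · rw [h1, h2]
      exact ⟨hp, h3⟩
    · rw [(hσ p).2, h1, h2, real_inner_comm]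
      exact ⟨hp.symm hσ, h3⟩
  refine hmax.false_of_conj (o := o) c (k₀ := i) (fun q => ?_) (by rw [ci]; exact dij.symm)
  by_cases h1 : q = i ∨ q = σ i
  · exact Or.inr (hmem hi ci csi hij q h1)
  by_cases h2 : q = j ∨ q = σ j
  · exact Or.inr (hmem hj cj csj hjk q h2)
  by_cases h3 : q = k ∨ q = σ k
  · exact Or.inr (hmem hk ck csk hki q h3)
  push Not at h1 h2 h3
  exact Or.inl ⟨cfix _ h1.1 h2.1 h3.1,
    cfix _ (hne h1.2.symm) (hne h2.2.symm) (hne h3.2.symm)⟩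

end Matching

/-- Corollary: for a max-sum matching of 2n points there is a point o with
‖a_i - o‖ + ‖b_i - o‖ ≤ √2 ‖a_i - b_i‖ for all matched pairs (a_i, b_i). -/
theorem stmt18 (n : ℕ) (x : Fin (2 * n) → Pt) (σ : Equiv.Perm (Fin (2 * n)))
    (hmax : IsMaxSumMatching x σ) :
    ∃ o : Pt, ∀ i, dist (x i) o + dist (x (σ i)) o ≤ Real.sqrt 2 * dist (x i) (x (σ i)) := by
  rcases isEmpty_or_nonempty (Fin (2 * n)) with hE | hE
  · exact ⟨0, fun i => isEmptyElim i⟩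
  obtain ⟨o, M, hM, hopt⟩ := exists_minimizer_sum_dist x (fun i => x (σ i))
    (fun i => √2 * dist (x i) (x (σ i)))
  refine ⟨o, fun i => ?_⟩
  have hσ := hmax.1
  suffices hM0 : M ≤ 0 by
    have := hM i
    simp only [dist_eq_norm] at this ⊢
    linarith
  by_contra! hM0
  let P : ℝ → Prop := fun θ => ∃ k α, IsLong x σ o k ∧ SpanArc (x k - o) (x (σ k) - o) θ α
  obtain ⟨θ₁, θ₂, θ₃, ⟨i₁, α₁, hl₁, hs₁⟩, ⟨i₂, α₂, hl₂, hs₂⟩, ⟨i₃, α₃, hl₃, hs₃⟩,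
    h1, h2, h3, h4, h5, h6⟩ := exists_three_angles (P := P)
      (by rintro θ k ⟨i, α, hl, hs⟩; exact ⟨i, α, hl, hs.add_int_mul_two_pi k⟩)
      (by
        intro φ
        obtain ⟨k, hk, hd⟩ := hopt (unitVec φ)
        have hl : IsLong x σ o k := by rw [IsLong]; linarith
        have hpos := hl.inner_pos
        have hd := hd (by rintro h; simp [h] at hpos) (by rintro h; simp [h] at hpos)
        have key : ∀ θ α u v, SpanArc u v θ α →
            inner ℝ u (unitVec φ) / ‖u‖ + inner ℝ v (unitVec φ) / ‖v‖ ≤ 0 →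
            cos (θ - φ) ≤ 0 := by
          intro θ α u v hs h
          rw [hs.inner_div_norm_add] at h
          have := cos_pos_of_mem_Ioo (x := α)
            ⟨by linarith [hs.1, Real.pi_pos], by linarith [hs.2.1, Real.pi_pos]⟩
          by_contra! hc
          exact absurd h (not_le.2 (by positivity))
        obtain ⟨θ, α, hs | hs⟩ := exists_spanArc hpos
        · exact ⟨θ, ⟨k, α, hl, hs⟩, key _ _ _ _ hs hd⟩
        · refine ⟨θ, ⟨σ k, α, hl.symm hσ, by rwa [(hσ k).2]⟩, key _ _ _ _ hs ?_⟩
          rwa [add_comm])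
      (by
        rintro θ θ' ⟨i, α, hl, hs⟩ ⟨i', α', hl', hs'⟩ h1 h2
        obtain ⟨ha, hb⟩ := hs.inner_nonpos_of_opposite hs' h1 h2
        exact hmax.false_of_two hl hl' ha hb)
  have hs₁' := hs₁.add_int_mul_two_pi 1
  exact hmax.false_of_three hl₁ hl₂ hl₃ (hs₁.inner_nonpos_of_next hs₂ h1 h2)
    (hs₂.inner_nonpos_of_next hs₃ h3 h4)
    (hs₃.inner_nonpos_of_next hs₁' (by push_cast; linarith) (by push_cast; linarith))
end
end
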